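/- arXiv:1603.04266 — 2 statements merged into one kernel-verified Lean document; each statement's English description precedes it below -/
import Mathlib

section
/- Let T be a tree of finite radius. Then the CR-ordinal ρ(T) equals the diameter of T. -/
universe u

open Ordinal

open Classical in
/-- The Nowakowski–Winkler relations `≤_α`: `u ≤_0 v` iff `u = v`; for `α > 0`,
`u ≤_α v` iff every `x ∈ N[u]` has some `y ∈ N[v]` with `x ≤_β y` for some `β < α`. -/
noncomputable def crRel {V : Type u} (G : SimpleGraph V) (α : Ordinal.{u}) (a b : V) : Prop :=
  if α = 0 then a = b
  else ∀ x ∈ insert a (G.neighborSet a), ∃ y ∈ insert b (G.neighborSet b),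
    ∃ β : Ordinal.{u}, ∃ _ : β < α, crRel G β x y
termination_by α
decreasing_by assumption

/-- The CR-ordinal `ρ(G)`: the least ordinal where the tower `≤_α` stabilizes. -/
noncomputable def CRord {V : Type u} (G : SimpleGraph V) : Ordinal.{u} :=
  sInf {ρ : Ordinal.{u} | crRel G ρ = crRel G (ρ + 1)}

/-- `G` is cop-win when the stabilized relation is trivial. -/
def CopWin {V : Type u} (G : SimpleGraph V) : Prop :=
  ∀ a b : V, crRel G (CRord G) a b

/-- `η(u, v)`: least `α` with `u ≤_α v`. -/
noncomputable def etaPair {V : Type u} (G : SimpleGraph V) (a b : V) : Ordinal.{u} :=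
  sInf {α : Ordinal.{u} | crRel G α a b}

/-- `η(v) = sup_u η(u, v)`. -/
noncomputable def etaVert {V : Type u} (G : SimpleGraph V) (b : V) : Ordinal.{u} :=
  ⨆ a : V, etaPair G a b

/-- `η(G) = min_v η(v)`. -/
noncomputable def etaG {V : Type u} (G : SimpleGraph V) : Ordinal.{u} :=
  ⨅ b : V, etaVert G b

/-- `θ(G)`: the vertices realizing `η(G)`. -/
def theta {V : Type u} (G : SimpleGraph V) : Set V :=
  {b | etaVert G b = etaG G}

/-- Eccentricity of a vertex, as an extended natural number. -/
noncomputable def ecc {V : Type u} (G : SimpleGraph V) (v : V) : ℕ∞ :=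
  ⨆ u : V, G.edist v u

/-- Radius: minimum eccentricity. -/
noncomputable def radius {V : Type u} (G : SimpleGraph V) : ℕ∞ :=
  ⨅ v : V, ecc G v

/-- Diameter: supremum of distances. -/
noncomputable def diam {V : Type u} (G : SimpleGraph V) : ℕ∞ :=
  ⨆ u : V, ⨆ v : V, G.edist u v

theorem crRel_zero {V : Type u} {G : SimpleGraph V} {a b : V} : crRel G 0 a b ↔ a = b := by
  rw [crRel]
  simp

theorem crRel_of_pos {V : Type u} {G : SimpleGraph V} {α : Ordinal.{u}} (hα : α ≠ 0) {a b : V} :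
    crRel G α a b ↔ ∀ x ∈ insert a (G.neighborSet a), ∃ y ∈ insert b (G.neighborSet b),
      ∃ β < α, crRel G β x y := by
  rw [crRel, if_neg hα]
  simp only [exists_prop]

theorem crRel_refl {V : Type u} (G : SimpleGraph V) (α : Ordinal.{u}) (a : V) :
    crRel G α a a := by
  rcases eq_or_ne α 0 with rfl | hα
  · exact crRel_zero.mpr rfl
  · exact (crRel_of_pos hα).mpr fun x hx ↦
      ⟨x, hx, 0, pos_iff_ne_zero.mpr hα, crRel_zero.mpr rfl⟩

theorem crRel_mono {V : Type u} {G : SimpleGraph V} {α β : Ordinal.{u}} (h : α ≤ β) {a b : V}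
    (hab : crRel G α a b) : crRel G β a b := by
  rcases eq_or_ne α 0 with rfl | hα
  · obtain rfl := crRel_zero.mp hab
    exact crRel_refl G β a
  · have hβ : β ≠ 0 := fun h0 ↦ hα (nonpos_iff_eq_zero.mp (h0 ▸ h))
    rw [crRel_of_pos hβ]
    intro x hx
    obtain ⟨y, hy, γ, hγ, hxy⟩ := (crRel_of_pos hα).mp hab x hx
    exact ⟨y, hy, γ, hγ.trans_le h, hxy⟩

theorem crRel_natCast_succ {V : Type u} {G : SimpleGraph V} {n : ℕ} {a b : V} :
    crRel G ((n + 1 : ℕ) : Ordinal.{u}) a b ↔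
      ∀ x ∈ insert a (G.neighborSet a), ∃ y ∈ insert b (G.neighborSet b),
        crRel G (n : Ordinal.{u}) x y := by
  rw [crRel_of_pos (by exact_mod_cast n.succ_ne_zero)]
  refine forall₂_congr fun x _ ↦ exists_congr fun y ↦ and_congr_right fun _ ↦ ⟨?_, fun h ↦ ?_⟩
  · rintro ⟨β, hβ, hxy⟩
    refine crRel_mono ?_ hxy
    rwa [Nat.cast_succ, ← Order.succ_eq_add_one, Order.lt_succ_iff] at hβ
  · exact ⟨n, by exact_mod_cast n.lt_succ_self, h⟩

theorem crRel_natCast_eq_of_eq_succ {V : Type u} {G : SimpleGraph V} {k : ℕ}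
    (h : crRel G (k : Ordinal.{u}) = crRel G ((k + 1 : ℕ) : Ordinal.{u})) {n : ℕ} (hn : k ≤ n) :
    crRel G (k : Ordinal.{u}) = crRel G (n : Ordinal.{u}) := by
  induction n, hn using Nat.le_induction with
  | base => rfl
  | succ n _ ih =>
    rw [h]
    funext a b
    rw [eq_iff_iff, crRel_natCast_succ, crRel_natCast_succ, ih]

/-- A robber who never moves is caught only after the cop has covered the distance. -/
theorem dist_le_of_crRel {V : Type u} {G : SimpleGraph V} (hG : G.Connected) {n : ℕ} {a b : V}
    (h : crRel G (n : Ordinal.{u}) a b) : G.dist a b ≤ n := by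
  induction n generalizing b with
  | zero =>
    obtain rfl := crRel_zero.mp (by simpa using h)
    simp
  | succ n ih =>
    obtain ⟨y, hy, hay⟩ := crRel_natCast_succ.mp h a (Set.mem_insert _ _)
    have hyb : G.dist y b ≤ 1 := by
      rcases hy with rfl | hy
      · simp
      · exact (SimpleGraph.dist_eq_one_iff_adj.mpr (G.adj_symm hy)).le
    exact hG.dist_triangle.trans (Nat.add_le_add (ih hay) hyb)

theorem SimpleGraph.Connected.exists_adj_dist_eq_add_one {V : Type u} {G : SimpleGraph V}
    (hG : G.Connected) {a b : V} (hab : a ≠ b) : ∃ w, G.Adj a w ∧ G.dist a b = G.dist w b + 1 := by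
  obtain ⟨p, hp⟩ := hG.exists_walk_length_eq_dist a b
  cases p with
  | nil => exact absurd rfl hab
  | @cons _ w _ h q =>
    refine ⟨w, h, ?_⟩
    have h1 := SimpleGraph.dist_le q
    have h2 : G.dist a b ≤ G.dist a w + G.dist w b := hG.dist_triangle
    rw [SimpleGraph.dist_eq_one_iff_adj.mpr h] at h2
    rw [SimpleGraph.Walk.length_cons] at hp
    omega

theorem SimpleGraph.IsTree.eq_of_adj_of_dist_add_one_eq {V : Type u} {T : SimpleGraph V}
    (hT : T.IsTree) {r u x y : V} (hx : T.Adj x u) (hy : T.Adj y u)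
    (hxd : T.dist r x + 1 = T.dist r u) (hyd : T.dist r y + 1 = T.dist r u) : x = y := by
  obtain ⟨p, hp⟩ := hT.connected.exists_walk_length_eq_dist r x
  obtain ⟨q, hq⟩ := hT.connected.exists_walk_length_eq_dist r y
  have hp' : (p.concat hx).IsPath :=
    SimpleGraph.Walk.isPath_of_length_eq_dist _ (by rw [SimpleGraph.Walk.length_concat, hp, hxd])
  have hq' : (q.concat hy).IsPath :=
    SimpleGraph.Walk.isPath_of_length_eq_dist _ (by rw [SimpleGraph.Walk.length_concat, hq, hyd])
  have h := congrArg SimpleGraph.Walk.penultimate ((hT.existsUnique_path r u).unique hp' hq')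
  simpa using h

/-- If `v` lies on the path from `r` to `u` and `u ≠ v`, then `v` also lies on the path from `r`
to any neighbour of `u`. -/
theorem SimpleGraph.IsTree.dist_eq_dist_add_dist_of_adj {V : Type u} {T : SimpleGraph V}
    (hT : T.IsTree) {r u v x : V} (hv : T.dist r u = T.dist r v + T.dist v u) (huv : u ≠ v)
    (hx : T.Adj u x) : T.dist r x = T.dist r v + T.dist v x := by
  have hxu := SimpleGraph.dist_eq_one_iff_adj.mpr hx
  have h1 : T.dist r x ≤ T.dist r v + T.dist v x := hT.connected.dist_triangle
  rcases hT.dist_eq_dist_add_one_of_adj r hx with h | h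
  · obtain ⟨w, hw, hwd⟩ := hT.connected.exists_adj_dist_eq_add_one huv
    rw [T.dist_comm, T.dist_comm (u := w)] at hwd
    have h2 : T.dist r w ≤ T.dist r v + T.dist v w := hT.connected.dist_triangle
    have h3 : T.dist r w + 1 = T.dist r u := by
      have := hT.dist_eq_dist_add_one_of_adj r hw
      omega
    obtain rfl := hT.eq_of_adj_of_dist_add_one_eq hx.symm hw.symm h.symm h3
    omega
  · have h2 : T.dist v x ≤ T.dist v u + T.dist u x := hT.connected.dist_triangle
    omega

/-- A cop who starts at `r`, has reached `v` by always moving towards the robber, and for whom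
the tree extends at most `n` further beyond `v`, catches the robber in at most `n` moves. -/
theorem SimpleGraph.IsTree.crRel_of_dist_le {V : Type u} {T : SimpleGraph V} (hT : T.IsTree)
    {r : V} {n : ℕ} {u v : V} (hr : ∀ w, T.dist r w ≤ T.dist r v + n)
    (huv : T.dist r u = T.dist r v + T.dist v u) : crRel T (n : Ordinal.{u}) u v := by
  induction n generalizing u v with
  | zero =>
    have := hr u
    have h0 : T.dist v u = 0 := by omega
    rw [Nat.cast_zero, crRel_zero]
    exact (hT.connected.dist_eq_zero_iff.mp h0).symm
  | succ n ih =>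
    rcases eq_or_ne u v with rfl | hne
    · exact crRel_refl T _ u
    rw [crRel_natCast_succ]
    intro x hx
    have hvx : T.dist r x = T.dist r v + T.dist v x := by
      rcases hx with rfl | hx
      · exact huv
      · exact hT.dist_eq_dist_add_dist_of_adj huv hne hx
    rcases eq_or_ne v x with rfl | hvx'
    · exact ⟨v, Set.mem_insert _ _, crRel_refl T _ v⟩
    obtain ⟨y, hy, hyd⟩ := hT.connected.exists_adj_dist_eq_add_one hvx'
    have h1 := SimpleGraph.dist_eq_one_iff_adj.mpr hy
    have h2 : T.dist r y ≤ T.dist r v + T.dist v y := hT.connected.dist_triangle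
    have h3 : T.dist r x ≤ T.dist r y + T.dist y x := hT.connected.dist_triangle
    refine ⟨y, Set.mem_insert_of_mem _ hy, ih (fun w ↦ ?_) (by omega)⟩
    have := hr w
    omega

theorem diam_ne_top_of_radius_ne_top {V : Type u} {G : SimpleGraph V} (h : radius G ≠ ⊤) :
    diam G ≠ ⊤ := by
  rw [show diam G = G.ediam from G.ediam_eq_iSup_iSup_edist.symm]
  exact ne_top_of_le_ne_top (WithTop.mul_ne_top (by decide) h) G.ediam_le_two_mul_radius

theorem diam_le_natCast_iff {V : Type u} {G : SimpleGraph V} (hG : G.Connected) {n : ℕ} :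
    diam G ≤ n ↔ ∀ a b, G.dist a b ≤ n := by
  simp only [diam, iSup_le_iff, ← (hG _ _).coe_dist_eq_edist, Nat.cast_le]

/-- In a tree of finite radius, the CR-ordinal `ρ(T)` equals the diameter. -/
theorem crOrd_eq_diam_of_finite_radius {V : Type u} (T : SimpleGraph V)
    (hT : T.IsTree) (hfin : radius T ≠ ⊤) :
    ∃ d : ℕ, diam T = (d : ℕ∞) ∧ CRord T = (d : Ordinal.{u}) := by
  obtain ⟨d, hd⟩ := ENat.ne_top_iff_exists.mp (diam_ne_top_of_radius_ne_top hfin)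
  refine ⟨d, hd.symm, ?_⟩
  have hall {n : ℕ} (hn : d ≤ n) (a b : V) : crRel T (n : Ordinal.{u}) a b :=
    hT.crRel_of_dist_le (r := b)
      (fun w ↦ by simpa using ((diam_le_natCast_iff hT.connected).mp hd.ge b w).trans hn) (by simp)
  have hmem : (d : Ordinal.{u}) ∈ {ρ : Ordinal.{u} | crRel T ρ = crRel T (ρ + 1)} := by
    funext a b
    exact eq_iff_iff.mpr (iff_of_true (hall le_rfl a b) (by exact_mod_cast hall d.le_succ a b))
  refine le_antisymm (csInf_le' hmem) (le_csInf ⟨_, hmem⟩ fun ρ hρ ↦ ?_)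
  by_contra! hlt
  obtain ⟨k, rfl⟩ := Ordinal.lt_omega0.mp (hlt.trans (Ordinal.natCast_lt_omega0 d))
  have hkd : k < d := by exact_mod_cast hlt
  have hk : crRel T (k : Ordinal.{u}) = crRel T (d : Ordinal.{u}) :=
    crRel_natCast_eq_of_eq_succ (by simpa using hρ) hkd.le
  have hle : diam T ≤ k := (diam_le_natCast_iff hT.connected).mpr fun a b ↦
    dist_le_of_crRel hT.connected (hk ▸ hall le_rfl a b)
  rw [← hd, Nat.cast_le] at hle
  omega
end

section
/- Let T be a cop-win tree of infinite radius. Then the capture-time ordinal η(T) is infinite (η(T) ≥ ω). -/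
universe u

open Ordinal

/-- A robber who stays put is reached only after the cop has covered the distance: `u ≤_n v`
with `n` finite forces the distance of `u` and `v` to be at most `n`. -/
theorem edist_le_of_crRel_natCast {V : Type u} (G : SimpleGraph V) (n : ℕ) (a b : V)
    (h : crRel G (n : Ordinal.{u}) a b) : G.edist a b ≤ n := by
  induction n using Nat.strong_induction_on generalizing b with
  | _ n ih =>
    rw [crRel] at h
    split_ifs at h with hn
    · subst h
      simp
    · obtain ⟨y, hy, β, hβ, hay⟩ := h a (Set.mem_insert _ _)
      obtain ⟨m, rfl⟩ := Ordinal.lt_omega0.1 (hβ.trans (Ordinal.natCast_lt_omega0 n))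
      have hmn : m < n := Nat.cast_lt.1 hβ
      have hyb : G.edist y b ≤ 1 := by
        rcases hy with rfl | hy
        · simp
        · exact (SimpleGraph.edist_eq_one_iff_adj.2 (SimpleGraph.Adj.symm hy)).le
      calc G.edist a b ≤ G.edist a y + G.edist y b := SimpleGraph.edist_triangle
        _ ≤ m + 1 := add_le_add (ih m hmn y hay) hyb
        _ ≤ n := by exact_mod_cast hmn

/-- A cop-win tree of infinite radius has infinite capture-time ordinal: `η(T) ≥ ω`. -/
theorem omega_le_etaG_of_infinite_radius {V : Type u} (T : SimpleGraph V)
    (hT : T.IsTree) (hwin : CopWin T) (hrad : radius T = ⊤) :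
    Ordinal.omega0 ≤ etaG T := by
  by_contra! hlt
  have : Nonempty V := hT.connected.nonempty
  obtain ⟨b, hb⟩ : ∃ b, etaVert T b = etaG T := ciInf_mem (etaVert T)
  obtain ⟨n, hn⟩ := Ordinal.lt_omega0.1 hlt
  have hecc : ecc T b ≤ n := by
    refine iSup_le fun a => ?_
    have hle : etaPair T a b ≤ n := by
      rw [← hn, ← hb]
      exact Ordinal.le_iSup (fun a => etaPair T a b) a
    have hrel : crRel T (etaPair T a b) a b :=
      csInf_mem (s := {α : Ordinal.{u} | crRel T α a b}) ⟨_, hwin a b⟩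
    obtain ⟨m, hm⟩ := Ordinal.lt_omega0.1 (hle.trans_lt (Ordinal.natCast_lt_omega0 n))
    rw [hm] at hle hrel
    rw [SimpleGraph.edist_comm]
    exact (edist_le_of_crRel_natCast T m a b hrel).trans (by exact_mod_cast hle)
  have hfin : radius T ≤ n := (iInf_le _ b).trans hecc
  rw [hrad] at hfin
  exact ENat.natCast_ne_top n (top_le_iff.1 hfin)
end
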